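/- Let X₁, …, X_{n+1} be compact subsets of ℝⁿ and let ρ be a metric on ℝⁿ that is continuous with respect to the Euclidean topology. For x ∈ ℝⁿ let f_i(x) be the set of points of X_i farthest from x in the metric ρ. Then there exists x ∈ ℝⁿ with x ∈ f₁(x) * ⋯ * f_{n+1}(x). -/

import Mathlib

open MeasureTheory Finset Metric

/-- det (1 + t A) is interpolated in t by finitely many small nodes. -/
lemma det_interp {n : ℕ} (M : Matrix (Fin n) (Fin n) ℝ) (s : Fin (n+1) → ℝ) (hs : Function.Injective s) (t : ℝ) :
    (1 + t • M).det = ∑ j, (Lagrange.basis univ s j).eval t * (1 + s j • M).det := by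
  classical
  set p : Polynomial ℝ := Matrix.det ((Polynomial.X : Polynomial ℝ) • M.map Polynomial.C + (1 : Matrix (Fin n) (Fin n) ℝ).map Polynomial.C) with hp
  have hev : ∀ r, p.eval r = (1 + r • M).det := by
    intro r
    rw [hp, ← Polynomial.coe_evalRingHom, RingHom.map_det]
    congr 1
    ext i j
    simp [Matrix.one_apply, add_comm]
    split_ifs <;> simp [mul_comm]
  have hdeg : p.natDegree ≤ n := by
    have := Polynomial.natDegree_det_X_add_C_le M (1 : Matrix (Fin n) (Fin n) ℝ)
    rwa [Fintype.card_fin] at this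
  have h := Lagrange.eq_interpolate (s := (univ : Finset (Fin (n+1)))) (v := s) (f := p) hs.injOn (by
    simp only [card_univ, Fintype.card_fin]
    refine lt_of_le_of_lt Polynomial.degree_le_natDegree ?_
    exact_mod_cast Nat.lt_succ_of_le hdeg)
  have h' := congrArg (Polynomial.eval t) h
  rw [Lagrange.interpolate_apply, Polynomial.eval_finsetSum] at h'
  rw [← hev t, h']
  refine Finset.sum_congr rfl fun j _ => ?_
  simp [hev, mul_comm]

lemma det_interp' {n : ℕ} (A : EuclideanSpace ℝ (Fin n) →L[ℝ] EuclideanSpace ℝ (Fin n)) (s : Fin (n+1) → ℝ) (hs : Function.Injective s) (t : ℝ) :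
    (1 + t • A).det = ∑ j, (Lagrange.basis univ s j).eval t * (1 + s j • A).det := by
  have key : ∀ r : ℝ, (1 + r • A).det = (1 + r • LinearMap.toMatrix (EuclideanSpace.basisFun (Fin n) ℝ).toBasis (EuclideanSpace.basisFun (Fin n) ℝ).toBasis (A : _ →ₗ[ℝ] _)).det := by
    intro r
    rw [ContinuousLinearMap.det, ← LinearMap.det_toMatrix (EuclideanSpace.basisFun (Fin n) ℝ).toBasis]
    congr 1
    rw [ContinuousLinearMap.toLinearMap_add, map_add, ContinuousLinearMap.toLinearMap_smul, map_smul]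
    congr 1
    exact LinearMap.toMatrix_one _
  simp_rw [key]
  exact det_interp _ s hs t

lemma det_ne_zero_of_small {n : ℕ} (A : EuclideanSpace ℝ (Fin n) →L[ℝ] EuclideanSpace ℝ (Fin n)) (r : ℝ) (h : |r| * ‖A‖ < 1) :
    (1 + r • A).det ≠ 0 := by
  intro h0
  have := LinearMap.bot_lt_ker_of_det_eq_zero h0
  obtain ⟨x, hx, hx0⟩ := (Submodule.ne_bot_iff _).1 this.ne'
  have hx' : x + r • A x = 0 := by simpa using hx
  have h1 : ‖x‖ = |r| * ‖A x‖ := by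
    conv_lhs => rw [eq_neg_of_add_eq_zero_left hx', norm_neg, norm_smul, Real.norm_eq_abs]
  have h2 : ‖x‖ ≤ |r| * ‖A‖ * ‖x‖ := by
    calc ‖x‖ = |r| * ‖A x‖ := h1
      _ ≤ |r| * (‖A‖ * ‖x‖) := by gcongr; exact A.le_opNorm x
      _ = _ := by ring
  have : 0 < ‖x‖ := norm_pos_iff.2 hx0
  nlinarith

lemma det_pos_of_small {n : ℕ} (A : EuclideanSpace ℝ (Fin n) →L[ℝ] EuclideanSpace ℝ (Fin n)) (r : ℝ) (hr : 0 ≤ r) (h : r * ‖A‖ < 1) :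
    0 < (1 + r • A).det := by
  by_contra hneg
  push Not at hneg
  have hc : Continuous (fun t : ℝ => (1 + t • A).det) := by
    apply ContinuousLinearMap.continuous_det.comp
    fun_prop
  have := intermediate_value_Icc' hr hc.continuousOn
  have h1 : (0:ℝ) ∈ Set.Icc ((1 + r • A).det) ((1 + (0:ℝ) • A).det) := by
    refine ⟨hneg, ?_⟩
    have e0 : (1 + (0:ℝ) • A) = 1 := by ext; simp
    rw [e0]
    have : (1 : EuclideanSpace ℝ (Fin n) →L[ℝ] EuclideanSpace ℝ (Fin n)).det = 1 := by
      simp [ContinuousLinearMap.det]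
    rw [this]; norm_num
  obtain ⟨t, ht, ht0⟩ := this h1
  refine det_ne_zero_of_small A t ?_ ht0
  rw [abs_of_nonneg ht.1]
  exact lt_of_le_of_lt (mul_le_mul_of_nonneg_right ht.2 (norm_nonneg _)) h

/-- No-retraction: Lipschitz, differentiable in the ball. -/
lemma no_retraction {n : ℕ} (R : ℝ) (hR : 0 < R) (h : EuclideanSpace ℝ (Fin n) → EuclideanSpace ℝ (Fin n))
    (L : NNReal) (hL : LipschitzWith L h) (hout : ∀ x, x ∉ ball (0 : EuclideanSpace ℝ (Fin n)) R → h x = 0)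
    (hd : ∀ x ∈ ball (0 : EuclideanSpace ℝ (Fin n)) R, DifferentiableAt ℝ h x)
    (hsph : ∀ x ∈ ball (0 : EuclideanSpace ℝ (Fin n)) R, ‖x + h x‖ = R) : False := by
  set B := ball (0 : EuclideanSpace ℝ (Fin n)) R with hB
  have hvol : 0 < volume.real B := by
    refine ENNReal.toReal_pos (measure_ball_pos _ _ hR).ne' measure_ball_lt_top.ne
  -- small t
  have small : ∀ t : ℝ, 0 ≤ t → t * L < 1 → ∫ x in B, (1 + t • fderiv ℝ h x).det = volume.real B := by
    intro t ht htL
    set φ : EuclideanSpace ℝ (Fin n) → EuclideanSpace ℝ (Fin n) := fun x => x + t • h x with hφ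
    have hinj : Function.Injective φ := by
      intro x y hxy
      have h1 : x - y = t • (h y - h x) := by
        simp only [hφ] at hxy
        rw [smul_sub]
        rw [sub_eq_sub_iff_add_eq_add, hxy, add_comm]
      have h2 : ‖x - y‖ ≤ t * L * ‖x - y‖ := by
        calc ‖x - y‖ = t * ‖h y - h x‖ := by
              conv_lhs => rw [h1, norm_smul, Real.norm_eq_abs, abs_of_nonneg ht]
          _ ≤ t * (L * ‖y - x‖) := by gcongr; exact hL.norm_sub_le y x
          _ = _ := by rw [norm_sub_rev]; ring
      have : ‖x - y‖ = 0 := by nlinarith [norm_nonneg (x - y)]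
      exact sub_eq_zero.1 (norm_eq_zero.1 this)
    have hsurj : Function.Surjective φ := by
      intro y
      have hc : ContractingWith (Real.toNNReal t * L) (fun x => y - t • h x) := by
        constructor
        · rw [← NNReal.coe_lt_coe]; simpa [Real.coe_toNNReal _ ht] using htL
        · refine LipschitzWith.of_dist_le_mul fun a b => ?_
          rw [dist_sub_left, dist_smul₀, Real.norm_eq_abs, abs_of_nonneg ht]
          push_cast
          rw [Real.coe_toNNReal _ ht, mul_assoc]
          gcongr
          exact hL.dist_le_mul a b
      refine ⟨hc.fixedPoint _, ?_⟩
      have := hc.fixedPoint_isFixedPt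
      have h3 : y - t • h (hc.fixedPoint _) = hc.fixedPoint _ := this
      simp only [hφ]
      nth_rewrite 1 [← h3]
      abel
    have hφout : ∀ x, x ∉ B → φ x = x := fun x hx => by simp [hφ, hout x hx]
    have himg : φ '' B = B := by
      ext y; constructor
      · rintro ⟨x, hx, rfl⟩
        by_contra hy
        have := hinj (hφout _ hy)
        rw [this] at hy
        exact hy hx
      · intro hy
        obtain ⟨x, rfl⟩ := hsurj y
        by_cases hx : x ∈ B
        · exact ⟨x, hx, rfl⟩
        · rw [hφout x hx] at hy; exact absurd hy hx
    have hder : ∀ x ∈ B, HasFDerivWithinAt φ (1 + t • fderiv ℝ h x) B x := by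
      intro x hx
      exact ((hasFDerivAt_id x).add ((hd x hx).hasFDerivAt.const_smul t)).hasFDerivWithinAt
    have hcv := integral_image_eq_integral_abs_det_fderiv_smul volume (measurableSet_ball : MeasurableSet B) hder hinj.injOn (fun _ => (1:ℝ))
    rw [himg] at hcv
    simp only [smul_eq_mul, mul_one, integral_const, measureReal_restrict_apply_univ] at hcv
    rw [hcv]
    refine setIntegral_congr_fun measurableSet_ball fun x hx => ?_
    refine (abs_of_pos (det_pos_of_small _ t ht ?_)).symm
    refine lt_of_le_of_lt ?_ htL
    gcongr
    exact norm_fderiv_le_of_lipschitz ℝ hL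
  -- nodes
  set s : Fin (n+1) → ℝ := fun j => (j : ℝ) / ((n + 1) * (L + 1)) with hs
  have hLpos : (0:ℝ) ≤ L := L.2
  have hpos : (0:ℝ) < (n + 1) * (L + 1) := by positivity
  have hsinj : Function.Injective s := by
    intro a b hab
    simp only [hs] at hab
    rw [div_left_inj' hpos.ne'] at hab
    exact Fin.ext (by exact_mod_cast hab)
  have hs0 : ∀ j, 0 ≤ s j := fun j => by simp only [hs]; positivity
  have hsL : ∀ j, s j * L < 1 := by
    intro j
    simp only [hs]
    rw [div_mul_eq_mul_div, div_lt_one hpos]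
    have : (j : ℝ) < n + 1 := by exact_mod_cast j.2
    nlinarith
  have hI := fun j => small (s j) (hs0 j) (hsL j)
  have hint : ∀ j, IntegrableOn (fun x => (1 + s j • fderiv ℝ h x).det) B := by
    intro j
    by_contra hni
    have := integral_undef hni
    rw [hI j] at this
    exact hvol.ne' this
  have h1 : ∫ x in B, (1 + (1:ℝ) • fderiv ℝ h x).det = volume.real B := by
    simp_rw [det_interp' _ s hsinj 1]
    rw [integral_finsetSum _ (fun j _ => (hint j).const_mul _)]
    simp_rw [integral_const_mul, hI]
    rw [← Finset.sum_mul, ← Polynomial.eval_finsetSum, Lagrange.sum_basis hsinj.injOn univ_nonempty]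
    simp
  have h2 : ∫ x in B, (1 + (1:ℝ) • fderiv ℝ h x).det = 0 := by
    refine setIntegral_eq_zero_of_forall_eq_zero fun x hx => ?_
    by_contra hne
    have hder : HasFDerivAt (fun x => x + h x) (1 + (1:ℝ) • fderiv ℝ h x) x := by
      rw [one_smul]
      exact (hasFDerivAt_id x).add (hd x hx).hasFDerivAt
    set D := (1 + (1:ℝ) • fderiv ℝ h x) with hD
    have hsq := hder.norm_sq
    have hconst : (fun x => ‖x + h x‖ ^ 2) =ᶠ[nhds x] fun _ => R ^ 2 := by
      filter_upwards [isOpen_ball.mem_nhds hx] with y hy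
      rw [hsph y hy]
    have hz := (hsq.congr_of_eventuallyEq hconst.symm).unique (hasFDerivAt_const (R^2) x)
    have hbij : Function.Surjective D := by
      have := (LinearMap.equivOfDetNeZero (D : EuclideanSpace ℝ (Fin n) →ₗ[ℝ] EuclideanSpace ℝ (Fin n)) hne).surjective
      exact this
    obtain ⟨v, hv⟩ := hbij (x + h x)
    have := congrArg (fun T => T v) hz
    simp only [smul_apply, ContinuousLinearMap.comp_apply, hv, innerSL_apply_apply, real_inner_self_eq_norm_sq, zero_apply] at this
    have hn := hsph x hx
    rw [hn] at this
    simp [hR.ne'] at this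
  exact hvol.ne' (h1.symm.trans h2)

/-- Brouwer for maps that are C^1 near the closed ball. -/
lemma smooth_brouwer {n : ℕ} (R : ℝ) (hR : 0 < R) (F : EuclideanSpace ℝ (Fin n) → EuclideanSpace ℝ (Fin n))
    (hF : ∀ x ∈ closedBall (0 : EuclideanSpace ℝ (Fin n)) R, ContDiffAt ℝ 1 F x)
    (hmap : ∀ x ∈ closedBall (0 : EuclideanSpace ℝ (Fin n)) R, F x ∈ closedBall (0 : EuclideanSpace ℝ (Fin n)) R) :
    ∃ x ∈ closedBall (0 : EuclideanSpace ℝ (Fin n)) R, F x = x := by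
  classical
  by_contra hno
  push Not at hno
  set u : EuclideanSpace ℝ (Fin n) → EuclideanSpace ℝ (Fin n) := fun x => x - F x with hu
  have hu0 : ∀ x ∈ closedBall (0 : EuclideanSpace ℝ (Fin n)) R, 0 < ‖u x‖ := fun x hx =>
    norm_pos_iff.2 (sub_ne_zero.2 (hno x hx).symm)
  set Δ : EuclideanSpace ℝ (Fin n) → ℝ := fun x => (inner ℝ x (u x))^2 + ‖u x‖^2 * (R^2 - ‖x‖^2) with hΔ
  -- positivity on the sphere
  have hin : ∀ x ∈ closedBall (0 : EuclideanSpace ℝ (Fin n)) R, ‖x‖ = R → 0 < inner ℝ x (u x) := by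
    intro x hx hxR
    have h1 := hu0 x hx
    have h2 : ‖F x‖ ≤ R := by simpa using hmap x hx
    have h3 : ‖u x‖^2 = ‖x‖^2 - 2 * inner ℝ x (F x) + ‖F x‖^2 := norm_sub_sq_real x (F x)
    have h4 : inner ℝ x (u x) = ‖x‖^2 - inner ℝ x (F x) := by
      simp only [hu, inner_sub_right, real_inner_self_eq_norm_sq]
    rw [h4]
    have h5 : ‖F x‖^2 ≤ R^2 := by gcongr
    rw [hxR] at h3 ⊢
    have : 0 < ‖u x‖^2 := by positivity
    nlinarith
  have hΔpos : ∀ x ∈ closedBall (0 : EuclideanSpace ℝ (Fin n)) R, 0 < Δ x := by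
    intro x hx
    have hxR : ‖x‖ ≤ R := by simpa using hx
    have h1 := hu0 x hx
    rcases hxR.eq_or_lt with h | h
    · have := hin x hx h
      simp only [hΔ, h]
      nlinarith
    · simp only [hΔ]
      have : 0 < R^2 - ‖x‖^2 := by nlinarith [norm_nonneg x]
      positivity
  set lam : EuclideanSpace ℝ (Fin n) → ℝ := fun x => (- inner ℝ x (u x) + Real.sqrt (Δ x)) / ‖u x‖^2 with hlam
  set h0 : EuclideanSpace ℝ (Fin n) → EuclideanSpace ℝ (Fin n) := fun x => lam x • u x with hh0
  have hcd : ∀ x ∈ closedBall (0 : EuclideanSpace ℝ (Fin n)) R, ContDiffAt ℝ 1 h0 x := by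
    intro x hx
    have c1 : ContDiffAt ℝ 1 u x := contDiffAt_id.sub (hF x hx)
    have c2 : ContDiffAt ℝ 1 (fun x => (inner ℝ x (u x) : ℝ)) x := contDiffAt_id.inner ℝ c1
    have c3 : ContDiffAt ℝ 1 (fun x => ‖u x‖^2) x := c1.norm_sq ℝ
    have c4 : ContDiffAt ℝ 1 Δ x :=
      (c2.pow 2).add (c3.mul (contDiffAt_const.sub (contDiffAt_id.norm_sq ℝ)))
    have c5 : ContDiffAt ℝ 1 lam x :=
      (c2.neg.add (c4.sqrt (hΔpos x hx).ne')).div c3 (pow_pos (hu0 x hx) 2).ne'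
    exact c5.smul c1
  have hsph0 : ∀ x ∈ closedBall (0 : EuclideanSpace ℝ (Fin n)) R, ‖x + h0 x‖ = R := by
    intro x hx
    have h1 : ‖x + h0 x‖^2 = ‖x‖^2 + 2 * (lam x * inner ℝ x (u x)) + (lam x)^2 * ‖u x‖^2 := by
      rw [norm_add_sq_real, hh0]
      simp only [inner_smul_right, norm_smul, mul_pow, Real.norm_eq_abs, sq_abs]
    have h2 : lam x * ‖u x‖^2 = - inner ℝ x (u x) + Real.sqrt (Δ x) := by
      simp only [hlam]
      exact div_mul_cancel₀ _ (pow_pos (hu0 x hx) 2).ne'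
    have h3 : Real.sqrt (Δ x) ^ 2 = (inner ℝ x (u x))^2 + ‖u x‖^2 * (R^2 - ‖x‖^2) := Real.sq_sqrt (hΔpos x hx).le
    have h4 : 0 < ‖u x‖^2 := pow_pos (hu0 x hx) 2
    have h5 : ‖x + h0 x‖^2 = R^2 := by
      have : ‖u x‖^2 * (‖x + h0 x‖^2 - R^2) = 0 := by
        rw [h1]
        have h6 : Real.sqrt (Δ x) = lam x * ‖u x‖^2 + inner ℝ x (u x) := by linarith
        rw [h6] at h3
        linear_combination h3
      rcases mul_eq_zero.1 this with h | h
      · exact absurd h h4.ne'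
      · linarith
    exact (sq_eq_sq₀ (norm_nonneg _) hR.le).1 h5
  have hzero : ∀ x, ‖x‖ = R → h0 x = 0 := by
    intro x hxR
    have hx : x ∈ closedBall (0 : EuclideanSpace ℝ (Fin n)) R := by simp [hxR]
    have h1 := hin x hx hxR
    have : lam x = 0 := by
      simp only [hlam, hΔ, hxR]
      simp [Real.sqrt_sq h1.le]
    simp [hh0, this]
  obtain ⟨L, hL⟩ := LocallyLipschitzOn.exists_lipschitzOnWith_of_compact (isCompact_closedBall (0 : EuclideanSpace ℝ (Fin n)) R)
    (ContDiffOn.locallyLipschitzOn (convex_closedBall _ _) (fun x hx => (hcd x hx).contDiffWithinAt))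
  set h : EuclideanSpace ℝ (Fin n) → EuclideanSpace ℝ (Fin n) := fun x => if x ∈ ball (0 : EuclideanSpace ℝ (Fin n)) R then h0 x else 0 with hh
  have hin' : ∀ x ∈ ball (0 : EuclideanSpace ℝ (Fin n)) R, h x = h0 x := fun x hx => if_pos hx
  have hout : ∀ x, x ∉ ball (0 : EuclideanSpace ℝ (Fin n)) R → h x = 0 := fun x hx => if_neg hx
  have cross : ∀ x y, x ∈ ball (0 : EuclideanSpace ℝ (Fin n)) R → y ∉ ball (0 : EuclideanSpace ℝ (Fin n)) R →
      ‖h x‖ ≤ L * dist x y := by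
    intro x y hx hy
    have hc : Continuous (fun s : ℝ => ‖x + s • (y - x)‖) := by fun_prop
    have hiv := intermediate_value_Icc (zero_le_one (α := ℝ)) hc.continuousOn
    have hx' : ‖x‖ < R := by simpa using hx
    have hy' : R ≤ ‖y‖ := by simpa using hy
    obtain ⟨s, hs, hsR⟩ := hiv (show R ∈ _ by constructor <;> simp [hx'.le, hy'])
    have hz := hL.dist_le_mul x (ball_subset_closedBall hx) (x + s • (y - x)) (by simp [hsR])
    rw [hzero _ hsR, dist_zero_right, ← hin' x hx] at hz
    refine hz.trans ?_
    gcongr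
    rw [dist_self_add_right, norm_smul, Real.norm_eq_abs, abs_of_nonneg hs.1, dist_eq_norm, norm_sub_rev x y]
    exact mul_le_of_le_one_left (norm_nonneg _) hs.2
  have hLip : LipschitzWith L h := by
    refine LipschitzWith.of_dist_le_mul fun x y => ?_
    by_cases hx : x ∈ ball (0 : EuclideanSpace ℝ (Fin n)) R <;> by_cases hy : y ∈ ball (0 : EuclideanSpace ℝ (Fin n)) R
    · rw [hin' x hx, hin' y hy]
      exact hL.dist_le_mul x (ball_subset_closedBall hx) y (ball_subset_closedBall hy)
    · rw [hout y hy, dist_zero_right]; exact cross x y hx hy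
    · rw [hout x hx, dist_zero_left, dist_comm]; exact cross y x hy hx
    · rw [hout x hx, hout y hy, dist_self]; positivity
  refine no_retraction R hR h L hLip hout (fun x hx => ?_) (fun x hx => ?_)
  · have := (hcd x (ball_subset_closedBall hx)).differentiableAt (by norm_num)
    refine this.congr_of_eventuallyEq ?_
    filter_upwards [isOpen_ball.mem_nhds hx] with y hy
    exact hin' y hy
  · rw [hin' x hx]; exact hsph0 x (ball_subset_closedBall hx)

lemma exists_color (n : ℕ) : ∃ c : (Fin n → ℤ) → Fin (n + 1),
    ∀ z z', c z = c z' → ((n : ℤ) + 1) ∣ (∑ i, z i) - ∑ i, z' i := by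
  have hb : ∀ z : Fin n → ℤ, ((∑ i, z i) % ((n : ℤ) + 1)).toNat < n + 1 := by
    intro z
    have h1 := Int.emod_nonneg (∑ i, z i) (show ((n : ℤ) + 1) ≠ 0 by omega)
    have h2 := Int.emod_lt_of_pos (∑ i, z i) (show 0 < ((n : ℤ) + 1) by omega)
    omega
  refine ⟨fun z => ⟨_, hb z⟩, fun z z' h => ?_⟩
  have h' : ((∑ i, z i) % ((n : ℤ) + 1)).toNat = ((∑ i, z' i) % ((n : ℤ) + 1)).toNat := by
    simpa using h
  have h1 := Int.emod_nonneg (∑ i, z i) (show ((n : ℤ) + 1) ≠ 0 by omega)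
  have h2 := Int.emod_nonneg (∑ i, z' i) (show ((n : ℤ) + 1) ≠ 0 by omega)
  exact Int.ModEq.dvd (show (∑ i, z' i) % ((n : ℤ) + 1) = (∑ i, z i) % ((n : ℤ) + 1) by omega)

/-- Two lattice points of the same colour whose open stars meet are equal. -/
lemma color_sep {n : ℕ} (z z' : Fin n → ℤ) (a : Fin n → ℝ)
    (h1 : ∀ i, |a i - z i| < 1) (h2 : ∀ i j, |(a i - z i) - (a j - z j)| < 1)
    (h1' : ∀ i, |a i - z' i| < 1) (h2' : ∀ i j, |(a i - z' i) - (a j - z' j)| < 1)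
    (hd : ((n : ℤ) + 1) ∣ (∑ i, z i) - ∑ i, z' i) : z = z' := by
  have e1 : ∀ i, z i - z' i ≤ 1 ∧ -1 ≤ z i - z' i := by
    intro i
    have := abs_lt.1 (h1 i)
    have := abs_lt.1 (h1' i)
    have a1 : ((z i - z' i : ℤ) : ℝ) < (2 : ℤ) := by push_cast; linarith
    have a2 : ((-2 : ℤ) : ℝ) < ((z i - z' i : ℤ) : ℝ) := by push_cast; linarith
    have := Int.cast_lt.1 a1
    have := Int.cast_lt.1 a2
    omega
  have e2 : ∀ i j, (z i - z' i) - (z j - z' j) ≤ 1 := by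
    intro i j
    have := abs_lt.1 (h2 i j)
    have := abs_lt.1 (h2' i j)
    have a1 : (((z i - z' i) - (z j - z' j) : ℤ) : ℝ) < (2 : ℤ) := by push_cast; linarith
    have := Int.cast_lt.1 a1
    omega
  rw [← Finset.sum_sub_distrib] at hd
  have bd : ∀ (d : Fin n → ℤ), (∀ i, 0 ≤ d i) → (∀ i, d i ≤ 1) → ((n : ℤ) + 1) ∣ ∑ i, d i → ∀ i, d i = 0 := by
    intro d d0 d1 hdiv i
    have s1 : ∑ i, d i ≤ n := by
      calc ∑ i, d i ≤ ∑ i : Fin n, (1 : ℤ) := Finset.sum_le_sum fun i _ => d1 i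
        _ = n := by simp
    have s0 : 0 ≤ ∑ i, d i := Finset.sum_nonneg fun i _ => d0 i
    have : ∑ i, d i = 0 := Int.eq_zero_of_dvd_of_nonneg_of_lt s0 (by omega) hdiv
    exact (Finset.sum_eq_zero_iff_of_nonneg fun i _ => d0 i).1 this i (mem_univ i)
  funext i
  by_cases hneg : ∃ j, z j - z' j = -1
  · obtain ⟨j, hj⟩ := hneg
    have := bd (fun i => -(z i - z' i)) (fun i => by have := e2 i j; show 0 ≤ -(z i - z' i); omega)
      (fun i => by have := e1 i; show -(z i - z' i) ≤ 1; omega) (by rw [Finset.sum_neg_distrib]; exact (dvd_neg).2 hd) i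
    omega
  · push Not at hneg
    have := bd (fun i => (z i - z' i)) (fun i => by have := e1 i; have := hneg i; show 0 ≤ (z i - z' i); omega)
      (fun i => (e1 i).1) hd i
    omega

lemma colored_approx {n : ℕ} (R : ℝ) (hR : 0 < R)
    (g : Fin (n + 1) → EuclideanSpace ℝ (Fin n) → EuclideanSpace ℝ (Fin n))
    (hg : ∀ i z, g i z ∈ closedBall (0 : EuclideanSpace ℝ (Fin n)) R) (δ : ℝ) (hδ : 0 < δ) :
    ∃ x ∈ closedBall (0 : EuclideanSpace ℝ (Fin n)) R, ∃ (v : Fin (n + 1) → EuclideanSpace ℝ (Fin n)) (t : Fin (n + 1) → ℝ),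
      t ∈ stdSimplex ℝ (Fin (n + 1)) ∧ (∀ i, dist (v i) x ≤ δ) ∧ ∑ i, t i • g i (v i) = x := by
  classical
  obtain ⟨c, hc⟩ := exists_color n
  set ε : ℝ := δ / (n + 1) with hε
  have hεpos : 0 < ε := by positivity
  set P : (Fin n → ℤ) → EuclideanSpace ℝ (Fin n) := fun z => WithLp.toLp 2 (fun i => ε * (z i : ℝ)) with hP
  set w : (Fin n → ℤ) → EuclideanSpace ℝ (Fin n) → ℝ := fun z x =>
    (∏ i, Real.smoothTransition (1 - (x i / ε - z i)^2)) *
      ∏ i, ∏ j, Real.smoothTransition (1 - ((x i / ε - z i) - (x j / ε - z j))^2) with hw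
  have hw0 : ∀ z x, 0 ≤ w z x := fun z x => mul_nonneg
    (Finset.prod_nonneg fun i _ => Real.smoothTransition.nonneg _)
    (Finset.prod_nonneg fun i _ => Finset.prod_nonneg fun j _ => Real.smoothTransition.nonneg _)
  have hwne : ∀ z x, w z x ≠ 0 → (∀ i, |x i / ε - z i| < 1) ∧ ∀ i j, |(x i / ε - z i) - (x j / ε - z j)| < 1 := by
    intro z x h
    have st : ∀ d : ℝ, Real.smoothTransition (1 - d^2) ≠ 0 → |d| < 1 := by
      intro d hd
      by_contra hge
      push Not at hge
      apply hd
      apply Real.smoothTransition.zero_of_nonpos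
      have : 1 ≤ d^2 := by rw [← sq_abs]; nlinarith
      linarith
    have h' := mul_ne_zero_iff.1 h
    refine ⟨fun i => st _ (Finset.prod_ne_zero_iff.1 h'.1 i (mem_univ i)), fun i j => st _ ?_⟩
    exact Finset.prod_ne_zero_iff.1 (Finset.prod_ne_zero_iff.1 h'.2 i (mem_univ i)) j (mem_univ j)
  have hwcd : ∀ z, ContDiff ℝ 1 (w z) := by
    intro z
    have hco : ∀ i : Fin n, ContDiff ℝ 1 (fun x : EuclideanSpace ℝ (Fin n) => x i / ε - z i) := by
      intro i
      fun_prop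
    refine ContDiff.mul (contDiff_prod fun i _ => ?_) (contDiff_prod fun i _ => contDiff_prod fun j _ => ?_)
    · exact Real.smoothTransition.contDiff.comp (contDiff_const.sub ((hco i).pow 2))
    · exact Real.smoothTransition.contDiff.comp (contDiff_const.sub (((hco i).sub (hco j)).pow 2))
  set M : ℤ := ⌈R / ε⌉ + 1 with hM
  set Z : Finset (Fin n → ℤ) := Fintype.piFinset (fun _ => Finset.Icc (-M) M) with hZ
  set W : EuclideanSpace ℝ (Fin n) → ℝ := fun x => ∑ z ∈ Z, w z x with hW
  have hWpos : ∀ x ∈ closedBall (0 : EuclideanSpace ℝ (Fin n)) R, 0 < W x := by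
    intro x hx
    have hxR : ‖x‖ ≤ R := by simpa using hx
    refine Finset.sum_pos' (fun z _ => hw0 z x) ⟨fun i => ⌊x i / ε⌋, ?_, ?_⟩
    · rw [hZ, Fintype.mem_piFinset]
      intro i
      have h1 : |x i| ≤ R := by
        have := PiLp.norm_apply_le x i
        rw [Real.norm_eq_abs] at this
        exact this.trans hxR
      have h2 := abs_le.1 h1
      have h3 : x i / ε ≤ R / ε := by gcongr; exact h2.2
      have h4 : -(R / ε) ≤ x i / ε := by rw [← neg_div]; gcongr; exact h2.1
      have h5 := Int.le_ceil (R / ε)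
      rw [Finset.mem_Icc]
      constructor
      · rw [Int.le_floor, hM]; push_cast; linarith
      · have : (⌊x i / ε⌋ : ℝ) ≤ ((M : ℤ) : ℝ) := by
          rw [hM]; push_cast
          linarith [Int.floor_le (x i / ε)]
        exact_mod_cast this
    · have f1 : ∀ i, 0 ≤ x i / ε - ⌊x i / ε⌋ := fun i => by linarith [Int.floor_le (x i / ε)]
      have f2 : ∀ i, x i / ε - ⌊x i / ε⌋ < 1 := fun i => by linarith [Int.lt_floor_add_one (x i / ε)]
      refine mul_pos (Finset.prod_pos fun i _ => ?_) (Finset.prod_pos fun i _ => Finset.prod_pos fun j _ => ?_)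
      · apply Real.smoothTransition.pos_of_pos
        nlinarith [f1 i, f2 i]
      · apply Real.smoothTransition.pos_of_pos
        nlinarith [f1 i, f2 i, f1 j, f2 j]
  set F : EuclideanSpace ℝ (Fin n) → EuclideanSpace ℝ (Fin n) := fun x => ∑ z ∈ Z, (w z x / W x) • g (c z) (P z) with hF
  have hWcd : ContDiff ℝ 1 W := ContDiff.sum fun z _ => hwcd z
  have hsum1 : ∀ x ∈ closedBall (0 : EuclideanSpace ℝ (Fin n)) R, ∑ z ∈ Z, w z x / W x = 1 := by
    intro x hx
    rw [← Finset.sum_div]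
    exact div_self (hWpos x hx).ne'
  obtain ⟨x, hx, hfix⟩ := smooth_brouwer R hR F
    (fun x hx => ContDiffAt.sum fun z _ =>
      ((hwcd z).contDiffAt.div hWcd.contDiffAt (hWpos x hx).ne').smul contDiffAt_const)
    (fun x hx => (convex_closedBall _ _).sum_mem (fun z _ => div_nonneg (hw0 z x) (hWpos x hx).le)
      (hsum1 x hx) (fun z _ => hg _ _))
  have hch : ∀ i, ∃ v, dist v x ≤ δ ∧ ∀ z ∈ Z, c z = i → w z x ≠ 0 → P z = v := by
    intro i
    by_cases hex : ∃ z ∈ Z, c z = i ∧ w z x ≠ 0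
    · obtain ⟨z, hz, hzi, hzw⟩ := hex
      refine ⟨P z, ?_, fun z' hz' hzi' hzw' => ?_⟩
      · have h1 := (hwne z x hzw).1
        rw [EuclideanSpace.dist_eq]
        have hco : ∀ i, dist (P z i) (x i) ^ 2 ≤ ε ^ 2 := by
          intro i
          have h2 : P z i - x i = - (ε * (x i / ε - z i)) := by
            simp only [hP]
            field_simp
            ring
          rw [Real.dist_eq, h2, abs_neg, abs_mul, abs_of_pos hεpos]
          have h3 := h1 i
          have h4 : ε * |x i / ε - z i| ≤ ε := by nlinarith
          gcongr
        have hδε : δ = (n + 1) * ε := by rw [hε]; field_simp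
        calc √(∑ i, dist (P z i) (x i) ^ 2) ≤ √(δ ^ 2) := by
              apply Real.sqrt_le_sqrt
              calc ∑ i, dist (P z i) (x i) ^ 2 ≤ ∑ i : Fin n, ε ^ 2 := Finset.sum_le_sum fun i _ => hco i
                _ = n * ε ^ 2 := by simp
                _ ≤ δ ^ 2 := by
                  rw [hδε, mul_pow]
                  gcongr
                  have : (0:ℝ) ≤ n := by positivity
                  nlinarith
          _ = δ := Real.sqrt_sq hδ.le
      · have := color_sep z' z (fun i => x i / ε) (hwne z' x hzw').1 (hwne z' x hzw').2
          (hwne z x hzw).1 (hwne z x hzw).2 (hc z' z (hzi'.trans hzi.symm))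
        rw [this]
    · push Not at hex
      exact ⟨x, by simpa using hδ.le, fun z hz hzi hzw => absurd (hex z hz hzi) hzw⟩
  choose v hv1 hv2 using hch
  refine ⟨x, hx, v, fun i => ∑ z ∈ Z with c z = i, w z x / W x, ⟨fun i => ?_, ?_⟩, hv1, ?_⟩
  · exact Finset.sum_nonneg fun z _ => div_nonneg (hw0 z x) (hWpos x hx).le
  · rw [Finset.sum_fiberwise]
    exact hsum1 x hx
  · refine Eq.trans ?_ hfix
    simp only [hF]
    rw [← Finset.sum_fiberwise Z c]
    refine Finset.sum_congr rfl fun i _ => ?_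
    rw [Finset.sum_smul]
    refine Finset.sum_congr rfl fun z hz => ?_
    rw [Finset.mem_filter] at hz
    by_cases h0 : w z x = 0
    · simp [h0]
    · rw [hv2 i z hz.1 hz.2 h0, hz.2]

/-- Farthest-point corollary of the colorful fixed-point theorem: for `n+1` nonempty
compacta in `ℝⁿ` and a continuous metric `ρ` on `ℝⁿ`, some point `x` lies in the geometric
join of the sets of `ρ`-farthest points of the `X i` from `x`. -/
theorem farthest_point_join {n : ℕ}
    (X : Fin (n + 1) → Set (EuclideanSpace ℝ (Fin n)))
    (hcpt : ∀ i, IsCompact (X i)) (hne : ∀ i, (X i).Nonempty)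
    (ρ : EuclideanSpace ℝ (Fin n) → EuclideanSpace ℝ (Fin n) → ℝ)
    (hρcont : Continuous fun p : EuclideanSpace ℝ (Fin n) × EuclideanSpace ℝ (Fin n) => ρ p.1 p.2)
    (hsymm : ∀ x y, ρ x y = ρ y x)
    (hzero : ∀ x y, ρ x y = 0 ↔ x = y)
    (htri : ∀ x y z, ρ x z ≤ ρ x y + ρ y z) :
    ∃ x : EuclideanSpace ℝ (Fin n),
      ∃ (y : Fin (n + 1) → EuclideanSpace ℝ (Fin n)) (t : Fin (n + 1) → ℝ),
        (∀ i, y i ∈ {z ∈ X i | ∀ w ∈ X i, ρ x w ≤ ρ x z}) ∧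
        (∀ i, 0 ≤ t i) ∧ ∑ i, t i = 1 ∧ ∑ i, t i • y i = x := by
  -- a big ball
  obtain ⟨R, hR, hXR⟩ : ∃ R : ℝ, 0 < R ∧ ∀ i, X i ⊆ closedBall (0 : EuclideanSpace ℝ (Fin n)) R := by
    have hb : Bornology.IsBounded (⋃ i, X i) := Bornology.isBounded_iUnion.2 fun i => (hcpt i).isBounded
    obtain ⟨R, hR, h⟩ := hb.subset_closedBall_lt 0 0
    exact ⟨R, hR, fun i => (Set.subset_iUnion X i).trans h⟩
  have hfar : ∀ i x, ∃ y ∈ X i, ∀ w ∈ X i, ρ x w ≤ ρ x y := by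
    intro i x
    obtain ⟨y, hy, hmax⟩ := (hcpt i).exists_isMaxOn (hne i)
      (f := fun y => ρ x y) (hρcont.comp (by fun_prop : Continuous fun y => (x, y))).continuousOn
    exact ⟨y, hy, fun w hw => hmax hw⟩
  choose g hgX hgmax using hfar
  have happ := fun k : ℕ => colored_approx R hR g (fun i z => hXR i (hgX i z)) (1 / ((k : ℝ) + 1)) (by positivity)
  choose x hx v t ht hv hsum using happ
  have hK : IsCompact (closedBall (0 : EuclideanSpace ℝ (Fin n)) R ×ˢ ((Set.univ.pi X) ×ˢ stdSimplex ℝ (Fin (n + 1)))) :=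
    (isCompact_closedBall _ _).prod ((isCompact_univ_pi hcpt).prod (isCompact_stdSimplex ℝ _))
  obtain ⟨⟨x₀, y₀, t₀⟩, ⟨-, hy₀, ht₀⟩, φ, hφ, hlim⟩ := hK.tendsto_subseq
    (x := fun k => (x k, (fun i => g i (v k i)), t k))
    (fun k => ⟨hx k, fun i _ => hgX i _, ht k⟩)
  have lx : Filter.Tendsto (fun k => x (φ k)) Filter.atTop (nhds x₀) :=
    (continuous_fst.tendsto _).comp hlim
  have lyt := (continuous_snd.tendsto _).comp hlim
  have ly' := (continuous_fst.tendsto _).comp lyt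
  have ly : ∀ i, Filter.Tendsto (fun k => g i (v (φ k) i)) Filter.atTop (nhds (y₀ i)) :=
    fun i => ((continuous_apply i).tendsto _).comp ly'
  have lt' := (continuous_snd.tendsto _).comp lyt
  have lt : ∀ i, Filter.Tendsto (fun k => t (φ k) i) Filter.atTop (nhds (t₀ i)) :=
    fun i => ((continuous_apply i).tendsto _).comp lt'
  have lv : ∀ i, Filter.Tendsto (fun k => v (φ k) i) Filter.atTop (nhds x₀) := by
    intro i
    refine lx.congr_dist ?_
    refine squeeze_zero (fun _ => dist_nonneg) (fun k => ?_)
      ((tendsto_one_div_add_atTop_nhds_zero_nat (𝕜 := ℝ)).comp hφ.tendsto_atTop)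
    rw [dist_comm]
    exact hv (φ k) i
  refine ⟨x₀, y₀, t₀, fun i => ⟨hy₀ i (Set.mem_univ i), fun w hw => ?_⟩, ht₀.1, ht₀.2, ?_⟩
  · refine le_of_tendsto_of_tendsto'
      ((hρcont.tendsto (x₀, w)).comp ((lv i).prodMk_nhds tendsto_const_nhds))
      ((hρcont.tendsto (x₀, y₀ i)).comp ((lv i).prodMk_nhds (ly i))) fun k => ?_
    exact hgmax i _ w hw
  · refine tendsto_nhds_unique (tendsto_finsetSum _ fun i _ => (lt i).smul (ly i)) ?_
    simp_rw [hsum]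
    exact lx
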